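/- Let M be a Manin matrix over an associative algebra. Then the Newton identity holds: \partial_z \operatorname{cdet}(1 + zM) = \operatorname{cdet}(1+zM) \sum_{m\ge 0} (-z)^m \operatorname{tr}(M^{m+1}), where \operatorname{cdet}(1+zM) = \sum_{m=0}^N z^m \operatorname{tr}_{1,\ldots,m} A^{(m)} M_1 \cdots M_m. -/

import Mathlib

noncomputable section
open scoped Classical

/- Operators in `(End ℂ^N)^{⊗m} ⊗ A` are modelled as matrices over `A` indexed
by functions `Fin m → Fin N`. -/

variable {A : Type*} [Ring A] [Algebra ℂ A]

/-- `M` is a Manin matrix: `[M_{ij}, M_{kl}] = [M_{kj}, M_{il}]`. -/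
def IsManin {N : ℕ} (M : Matrix (Fin N) (Fin N) A) : Prop :=
  ∀ i j k l : Fin N,
    M i j * M k l - M k l * M i j = M k j * M i l - M i l * M k j

/-- The copy `M_a` of `M` acting on the `a`-th tensor factor. -/
def Mfac (N : ℕ) (M : Matrix (Fin N) (Fin N) A) (m : ℕ) (a : Fin m) :
    Matrix (Fin m → Fin N) (Fin m → Fin N) A := fun f g =>
  if ∀ b : Fin m, b ≠ a → f b = g b then M (f a) (g a) else 0

/-- The antisymmetrizer `A^{(m)}` on `(ℂ^N)^{⊗m}`, with scalar entries. -/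
def AsymM (N m : ℕ) : Matrix (Fin m → Fin N) (Fin m → Fin N) A := fun f g =>
  algebraMap ℂ A ((m.factorial : ℂ)⁻¹ *
    ∑ σ : Equiv.Perm (Fin m),
      if ∀ b : Fin m, f b = g (σ b) then ((Equiv.Perm.sign σ : ℤ) : ℂ) else 0)

/-- The symmetrizer `H^{(m)}` on `(ℂ^N)^{⊗m}`, with scalar entries. -/
def HsymM (N m : ℕ) : Matrix (Fin m → Fin N) (Fin m → Fin N) A := fun f g =>
  algebraMap ℂ A ((m.factorial : ℂ)⁻¹ *
    ∑ σ : Equiv.Perm (Fin m),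
      if ∀ b : Fin m, f b = g (σ b) then 1 else 0)

/-- `M₁ M₂ ⋯ M_m`. -/
def prodM (N : ℕ) (M : Matrix (Fin N) (Fin N) A) (m : ℕ) :
    Matrix (Fin m → Fin N) (Fin m → Fin N) A :=
  (List.ofFn fun a : Fin m => Mfac N M m a).prod

/-- `tr_{1,…,m} A^{(m)} M₁ ⋯ M_m`, the coefficient of `z^m` in `cdet(1+zM)`. -/
def cdetCoeff (N : ℕ) (M : Matrix (Fin N) (Fin N) A) (m : ℕ) : A :=
  Matrix.trace (AsymM N m * prodM N M m)

/-- `cdet(1+zM) = ∑_{m=0}^N z^m tr_{1,…,m} A^{(m)} M₁ ⋯ M_m` as a power series. -/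
def cdetSeries (N : ℕ) (M : Matrix (Fin N) (Fin N) A) : PowerSeries A :=
  PowerSeries.mk fun m => if m ≤ N then cdetCoeff N M m else 0

section

variable {R : Type*} [Ring R]

/-- The ordered product of the entries `M (f a) (g a)`. -/
def orderedProd {N m : ℕ} (M : Matrix (Fin N) (Fin N) R) (f g : Fin m → Fin N) : R :=
  (List.ofFn fun a => M (f a) (g a)).prod

/-- The column determinant of the matrix with entries `M (f a) (g b)`. -/
def columnDet {N m : ℕ} (M : Matrix (Fin N) (Fin N) R) (f g : Fin m → Fin N) : R :=
  ∑ σ : Equiv.Perm (Fin m), (Equiv.Perm.sign σ : ℤ) • orderedProd M (f ∘ σ) g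

/-- The column determinant of the matrix whose last column is taken from `B` and whose other
columns are taken from `M`. -/
def borderedDet {N m : ℕ} (M B : Matrix (Fin N) (Fin N) R) (f g : Fin (m + 1) → Fin N) : R :=
  ∑ σ : Equiv.Perm (Fin (m + 1)), (Equiv.Perm.sign σ : ℤ) •
    (orderedProd M (fun a => f (σ a.castSucc)) (fun a => g a.castSucc) *
      B (f (σ (Fin.last m))) (g (Fin.last m)))

theorem orderedProd_succ {N m : ℕ} (M : Matrix (Fin N) (Fin N) R) (f g : Fin (m + 1) → Fin N) :
    orderedProd M f g = orderedProd M (fun a => f a.castSucc) (fun a => g a.castSucc) *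
      M (f (Fin.last m)) (g (Fin.last m)) := by
  rw [orderedProd, List.ofFn_succ', List.concat_eq_append, List.prod_append]
  simp [orderedProd]

theorem borderedDet_self {N m : ℕ} (M : Matrix (Fin N) (Fin N) R) (f g : Fin (m + 1) → Fin N) :
    borderedDet M M f g = columnDet M f g := by
  simp only [borderedDet, columnDet, orderedProd_succ, Function.comp_apply]

/-- An ordered product depends on two adjacent factors only through their product. -/
theorem exists_prod_ofFn_eq_mul_adjacent {S : Type*} [Monoid S] {n : ℕ} (i : Fin n)
    (u : Fin (n + 1) → S) :
    ∃ l r : S, ∀ v : Fin (n + 1) → S, (∀ b, b ≠ i.castSucc → b ≠ i.succ → v b = u b) →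
      (List.ofFn v).prod = l * (v i.castSucc * v i.succ) * r := by
  induction n with
  | zero => exact i.elim0
  | succ n ih =>
    induction i using Fin.cases with
    | zero =>
      refine ⟨1, (List.ofFn fun a : Fin n => u a.succ.succ).prod, fun v hv => ?_⟩
      have h : (fun a : Fin n => v a.succ.succ) = fun a => u a.succ.succ := by
        funext a
        exact hv _ (Fin.succ_ne_zero _) fun h => Fin.succ_ne_zero a (Fin.succ_injective _ h)
      rw [List.ofFn_succ, List.ofFn_succ, h]
      simp [mul_assoc]
    | succ i =>
      obtain ⟨l, r, h⟩ := ih i fun a => u a.succ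
      refine ⟨u 0 * l, r, fun v hv => ?_⟩
      rw [List.ofFn_succ, List.prod_cons, h fun a => v a.succ, hv 0]
      · simp [mul_assoc]
      · exact fun h => Fin.succ_ne_zero i.castSucc (by rw [Fin.succ_castSucc, ← h])
      · exact (Fin.succ_ne_zero _).symm
      · intro b h₁ h₂
        refine hv _ (fun h => h₁ ?_) fun h => h₂ (Fin.succ_injective _ h)
        rw [← Fin.succ_castSucc] at h
        exact Fin.succ_injective _ h

theorem columnDet_comp_perm_left {N m : ℕ} (M : Matrix (Fin N) (Fin N) R) (f g : Fin m → Fin N)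
    (τ : Equiv.Perm (Fin m)) :
    columnDet M (f ∘ τ) g = (Equiv.Perm.sign τ : ℤ) • columnDet M f g := by
  simp only [columnDet, Finset.smul_sum, smul_smul]
  refine Fintype.sum_equiv (Equiv.mulLeft τ) _ _ fun σ => ?_
  have h : (Equiv.Perm.sign τ : ℤ) * (Equiv.Perm.sign τ : ℤ) = 1 := by
    rw [← Units.val_mul, Int.units_mul_self, Units.val_one]
  rw [Equiv.coe_mulLeft, Equiv.Perm.sign_mul, Units.val_mul, ← mul_assoc, h, one_mul]
  rfl

/-- The adjacent `2 × 2` minors of a Manin matrix are antisymmetric in the columns. -/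
theorem IsManin.orderedProd_add_comp_swap {N m : ℕ} {M : Matrix (Fin N) (Fin N) R}
    (hM : IsManin M) (f g : Fin (m + 1) → Fin N) (i : Fin m) :
    orderedProd M f g + orderedProd M f (g ∘ Equiv.swap i.castSucc i.succ) =
      orderedProd M (f ∘ Equiv.swap i.castSucc i.succ) g +
        orderedProd M (f ∘ Equiv.swap i.castSucc i.succ) (g ∘ Equiv.swap i.castSucc i.succ) := by
  obtain ⟨l, r, h⟩ := exists_prod_ofFn_eq_mul_adjacent i fun a => M (f a) (g a)
  simp only [orderedProd]
  rw [h _ fun _ _ _ => rfl, h, h, h]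
  · have key := hM (f i.castSucc) (g i.castSucc) (f i.succ) (g i.succ)
    simp only [Function.comp_apply, Equiv.swap_apply_left, Equiv.swap_apply_right]
    rw [← add_mul, ← mul_add, ← add_mul, ← mul_add]
    congr 2
    rw [sub_eq_sub_iff_add_eq_add] at key
    exact key
  all_goals
    intro b h₁ h₂
    simp [Equiv.swap_apply_of_ne_of_ne h₁ h₂]

theorem IsManin.columnDet_comp_swap_right {N m : ℕ} {M : Matrix (Fin N) (Fin N) R}
    (hM : IsManin M) (f g : Fin (m + 1) → Fin N) (i : Fin m) :
    columnDet M f (g ∘ Equiv.swap i.castSucc i.succ) = -columnDet M f g := by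
  have hne : i.castSucc ≠ i.succ := Fin.castSucc_lt_succ.ne
  rw [eq_neg_iff_add_eq_zero, columnDet, columnDet, ← Finset.sum_add_distrib]
  refine Finset.sum_involution (fun σ _ => σ * Equiv.swap i.castSucc i.succ) ?_ ?_ ?_ ?_
  · intro σ _
    have h := hM.orderedProd_add_comp_swap (f ∘ σ) g i
    rw [Equiv.Perm.sign_mul, Equiv.Perm.sign_swap hne, Equiv.Perm.coe_mul, ← Function.comp_assoc,
      ← smul_add, ← smul_add, add_comm (orderedProd M (f ∘ σ) _), h,
      add_comm (orderedProd M _ g), mul_neg_one, Units.val_neg, neg_smul, add_neg_cancel]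
  · intro σ _ _ h
    exact hne (Equiv.swap_eq_one_iff.mp (mul_eq_left.mp h))
  · simp
  · simp [mul_assoc]

theorem IsManin.columnDet_comp_perm_right {N m : ℕ} {M : Matrix (Fin N) (Fin N) R}
    (hM : IsManin M) (f g : Fin (m + 1) → Fin N) (τ : Equiv.Perm (Fin (m + 1))) :
    columnDet M f (g ∘ τ) = (Equiv.Perm.sign τ : ℤ) • columnDet M f g := by
  have hτ : τ ∈ Submonoid.closure
      (Set.range fun i : Fin m => Equiv.swap i.castSucc i.succ) := by
    rw [Equiv.Perm.mclosure_swap_castSucc_succ]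
    trivial
  induction hτ using Submonoid.closure_induction generalizing g with
  | mem τ h =>
    obtain ⟨i, rfl⟩ := h
    have hne : i.castSucc ≠ i.succ := Fin.castSucc_lt_succ.ne
    simp [hM.columnDet_comp_swap_right, Equiv.Perm.sign_swap hne]
  | one => simp
  | mul σ τ _ _ hσ hτ =>
    rw [Equiv.Perm.coe_mul, ← Function.comp_assoc, hτ, hσ, smul_smul, Equiv.Perm.sign_mul,
      Units.val_mul, mul_comm]

theorem IsManin.columnDet_comp_perm {N m : ℕ} {M : Matrix (Fin N) (Fin N) R}
    (hM : IsManin M) (f g : Fin (m + 1) → Fin N) (τ : Equiv.Perm (Fin (m + 1))) :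
    columnDet M (f ∘ τ) (g ∘ τ) = columnDet M f g := by
  rw [columnDet_comp_perm_left, hM.columnDet_comp_perm_right, smul_smul, ← Units.val_mul,
    Int.units_mul_self, Units.val_one, one_smul]

/-- Sums over permutations, split by the image of the last point. -/
theorem sum_perm_fin_succ {S : Type*} [AddCommMonoid S] {m : ℕ}
    (F : Equiv.Perm (Fin (m + 1)) → S) :
    ∑ σ, F σ = ∑ p : Option (Fin m), ∑ e : Equiv.Perm (Fin m),
      F (finSuccEquivLast.symm.permCongr (Equiv.swap none p * Equiv.optionCongr e)) := by
  rw [← Fintype.sum_prod_type']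
  exact (Fintype.sum_equiv
    (Equiv.Perm.decomposeOption.symm.trans finSuccEquivLast.symm.permCongr) _ _
    fun _ => rfl).symm

/-- Expansion of a bordered determinant along its last column. -/
theorem borderedDet_expand {N m : ℕ} (M B : Matrix (Fin N) (Fin N) R)
    (f g : Fin m → Fin N) (x y : Fin N) :
    borderedDet M B (Fin.snoc f x : Fin (m + 1) → Fin N) (Fin.snoc g y : Fin (m + 1) → Fin N) =
      columnDet M f g * B x y -
        ∑ j, columnDet M (Function.update f j x) g * B (f j) y := by
  rw [borderedDet, sum_perm_fin_succ, Fintype.sum_option, sub_eq_add_neg,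
    ← Finset.sum_neg_distrib]
  congr 1
  · rw [columnDet, Finset.sum_mul]
    refine Finset.sum_congr rfl fun e _ => ?_
    simp [Equiv.Perm.sign_permCongr, Equiv.permCongr_apply, Function.comp_def, mul_assoc]
  · refine Finset.sum_congr rfl fun j _ => ?_
    rw [columnDet, Finset.sum_mul, ← Finset.sum_neg_distrib]
    refine Finset.sum_congr rfl fun e _ => ?_
    have h : ∀ a : Fin m, (Fin.snoc f x : Fin (m + 1) → Fin N)
        (finSuccEquivLast.symm (Equiv.swap none (some j) (some (e a)))) =
          Function.update f j x (e a) := by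
      intro a
      by_cases ha : e a = j
      · simp [ha]
      · rw [Equiv.swap_apply_of_ne_of_ne (by simp) (by simpa using ha)]
        simp [ha]
    simp [Equiv.Perm.sign_permCongr, Equiv.permCongr_apply, Function.comp_def, h,
      mul_assoc]

theorem sum_fin_succ_fun {S α : Type*} [Fintype α] [AddCommMonoid S] {m : ℕ}
    (F : (Fin (m + 1) → α) → S) :
    ∑ g, F g = ∑ f : Fin m → α, ∑ x : α, F (Fin.snoc f x : Fin (m + 1) → α) := by
  rw [Finset.sum_comm, ← Fintype.sum_prod_type']
  exact (Fintype.sum_equiv (Fin.snocEquiv fun _ => α) _ _ fun _ => rfl).symm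

theorem sum_columnDet_snoc_mul {N m : ℕ} (M B : Matrix (Fin N) (Fin N) R)
    (f : Fin (m + 1) → Fin N) (g : Fin m → Fin N) (x : Fin N) :
    ∑ y, columnDet M f (Fin.snoc g y : Fin (m + 1) → Fin N) * B y x =
      borderedDet M (M * B) f (Fin.snoc g x : Fin (m + 1) → Fin N) := by
  simp only [columnDet, borderedDet, Finset.sum_mul]
  rw [Finset.sum_comm]
  refine Finset.sum_congr rfl fun σ _ => ?_
  simp [orderedProd_succ, Matrix.mul_apply, Finset.mul_sum, Finset.smul_sum, mul_assoc]

theorem IsManin.sum_columnDet_update {N m : ℕ} {M : Matrix (Fin N) (Fin N) R}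
    (hM : IsManin M) (B : Matrix (Fin N) (Fin N) R) (j : Fin (m + 1)) :
    ∑ f : Fin (m + 1) → Fin N, ∑ x, columnDet M (Function.update f j x) f * B (f j) x =
      ∑ f : Fin (m + 1) → Fin N, borderedDet M (M * B) f f := by
  trans ∑ f : Fin (m + 1) → Fin N, ∑ x,
    columnDet M (Function.update f (Fin.last m) x) f * B (f (Fin.last m)) x
  · refine Fintype.sum_equiv ((Equiv.swap j (Fin.last m)).arrowCongr (Equiv.refl (Fin N))) _ _
      fun f => Finset.sum_congr rfl fun x _ => ?_
    have hf : (Equiv.swap j (Fin.last m)).arrowCongr (Equiv.refl (Fin N)) f =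
        f ∘ Equiv.swap j (Fin.last m) := by
      ext
      simp
    have hu : Function.update (f ∘ Equiv.swap j (Fin.last m)) (Fin.last m) x =
        Function.update f j x ∘ Equiv.swap j (Fin.last m) := by
      rw [Function.update_comp_equiv]
      simp
    rw [hf, hu, hM.columnDet_comp_perm]
    simp
  · rw [sum_fin_succ_fun, sum_fin_succ_fun]
    refine Finset.sum_congr rfl fun f _ => ?_
    rw [Finset.sum_comm]
    refine Finset.sum_congr rfl fun x _ => ?_
    simp only [Fin.update_snoc_last, Fin.snoc_last]
    exact sum_columnDet_snoc_mul M B _ f x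

theorem sum_borderedDet_expand {N m : ℕ} (M B : Matrix (Fin N) (Fin N) R) :
    ∑ g : Fin (m + 1) → Fin N, borderedDet M B g g =
      (∑ f : Fin m → Fin N, columnDet M f f) * B.trace -
        ∑ j, ∑ f : Fin m → Fin N, ∑ x, columnDet M (Function.update f j x) f * B (f j) x := by
  rw [sum_fin_succ_fun]
  simp only [borderedDet_expand, Finset.sum_sub_distrib]
  congr 1
  · simp only [Matrix.trace, Matrix.diag, Finset.sum_mul, Finset.mul_sum]
    exact Finset.sum_comm
  · rw [Finset.sum_comm (s := (Finset.univ : Finset (Fin m)))]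
    exact Finset.sum_congr rfl fun f _ => Finset.sum_comm

theorem prod_map_Mfac_apply {N m : ℕ} (M : Matrix (Fin N) (Fin N) R) (l : List (Fin m))
    (hl : l.Nodup) (f g : Fin m → Fin N) :
    (l.map (Mfac N M m)).prod f g =
      if ∀ b ∉ l, f b = g b then (l.map fun a => M (f a) (g a)).prod else 0 := by
  induction l generalizing f with
  | nil => simp [Matrix.one_apply, funext_iff]
  | cons a l ih =>
    obtain ⟨ha, hl⟩ := List.nodup_cons.mp hl
    rw [List.map_cons, List.prod_cons, Matrix.mul_apply,
      Finset.sum_eq_single (Function.update f a (g a))]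
    · rw [ih hl]
      have hmap : (l.map fun b => M (Function.update f a (g a) b) (g b)) =
          l.map fun b => M (f b) (g b) := by
        refine List.map_congr_left fun b hb => ?_
        rw [Function.update_of_ne (ne_of_mem_of_not_mem hb ha)]
      have hiff : (∀ b ∉ l, Function.update f a (g a) b = g b) ↔ ∀ b ∉ a :: l, f b = g b := by
        refine forall_congr' fun b => ?_
        by_cases hb : b = a
        · subst hb
          simp
        · simp [hb]
      have hfac : Mfac N M m a f (Function.update f a (g a)) = M (f a) (g a) := by
        rw [Mfac, if_pos fun b hb => by rw [Function.update_of_ne hb], Function.update_self]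
      simp only [hfac, hmap, hiff, List.map_cons, List.prod_cons, mul_ite, mul_zero]
    · intro h _ hne
      by_cases h₁ : ∀ b, b ≠ a → f b = h b
      · rw [ih hl, if_neg, mul_zero]
        intro h₂
        refine hne (funext fun b => ?_)
        by_cases hb : b = a
        · subst hb
          simpa using h₂ b ha
        · simp [hb, h₁ b hb]
      · rw [Mfac, if_neg h₁, zero_mul]
    · simp

theorem prodM_apply {N m : ℕ} (M : Matrix (Fin N) (Fin N) R) (f g : Fin m → Fin N) :
    prodM N M m f g = orderedProd M f g := by
  rw [prodM, List.ofFn_eq_map, prod_map_Mfac_apply M _ (List.nodup_finRange m)]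
  simp [orderedProd, List.ofFn_eq_map]

end

/-- The bordered form of Newton's identity. -/
theorem IsManin.sum_borderedDet {N : ℕ} {M : Matrix (Fin N) (Fin N) A}
    (hM : IsManin M) (B : Matrix (Fin N) (Fin N) A) (n : ℕ) :
    ((n.factorial : ℂ)⁻¹ • ∑ g : Fin (n + 1) → Fin N, borderedDet M B g g) =
      ∑ p ∈ Finset.HasAntidiagonal.antidiagonal n,
        ((p.1.factorial : ℂ)⁻¹ • ∑ f : Fin p.1 → Fin N, columnDet M f f) *
          ((-1 : ℤ) ^ p.2 • (M ^ p.2 * B).trace) := by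
  induction n generalizing B with
  | zero => simp [sum_borderedDet_expand]
  | succ n ih =>
    rw [Finset.Nat.sum_antidiagonal_succ', sum_borderedDet_expand]
    simp only [hM.sum_columnDet_update, Finset.sum_const, Finset.card_univ, Fintype.card_fin]
    have h : ((n + 1).factorial : ℂ)⁻¹ • (n + 1) •
        ∑ f : Fin (n + 1) → Fin N, borderedDet M (M * B) f f =
          (n.factorial : ℂ)⁻¹ • ∑ f : Fin (n + 1) → Fin N, borderedDet M (M * B) f f := by
      rw [← Nat.cast_smul_eq_nsmul ℂ, smul_smul]
      congr 1
      rw [Nat.factorial_succ]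
      push_cast
      field_simp
    rw [smul_sub, h, ih]
    simp [pow_succ, mul_assoc, sub_eq_add_neg]

theorem cdetCoeff_eq {N m : ℕ} (M : Matrix (Fin N) (Fin N) A) :
    cdetCoeff N M m = (m.factorial : ℂ)⁻¹ • ∑ f : Fin m → Fin N, columnDet M f f := by
  have hA : ∀ f g : Fin m → Fin N, (AsymM N m f g : A) = (m.factorial : ℂ)⁻¹ •
      ∑ σ : Equiv.Perm (Fin m), if g = f ∘ σ then ((Equiv.Perm.sign σ : ℤ) : A) else 0 := by
    intro f g
    rw [AsymM, map_mul, ← Algebra.smul_def, map_sum]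
    congr 1
    refine Fintype.sum_equiv (Equiv.inv _) _ _ fun σ => ?_
    have h : (∀ b, f b = g (σ b)) ↔ g = f ∘ (σ⁻¹ : Equiv.Perm (Fin m)) := by
      exact funext_iff.symm.trans (eq_comm.trans (Equiv.eq_comp_symm σ g f).symm)
    simp only [Equiv.inv_apply, Equiv.Perm.sign_inv, ← h]
    split_ifs <;> simp
  simp only [cdetCoeff, Matrix.trace, Matrix.diag, Matrix.mul_apply, hA, prodM_apply,
    smul_mul_assoc, Finset.sum_mul, ← Finset.smul_sum, columnDet]
  congr 1
  refine Finset.sum_congr rfl fun f _ => ?_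
  rw [Finset.sum_comm]
  refine Finset.sum_congr rfl fun σ _ => ?_
  simp [ite_mul]

theorem columnDet_eq_zero {N m : ℕ} (M : Matrix (Fin N) (Fin N) A) (f g : Fin m → Fin N)
    (hf : ¬ Function.Injective f) : columnDet M f g = 0 := by
  obtain ⟨i, j, hij, hne⟩ := Function.not_injective_iff.mp hf
  have hswap : f ∘ Equiv.swap i j = f := by
    funext b
    rw [Function.comp_apply, Equiv.swap_apply_def]
    split_ifs with h₁ h₂
    · rw [h₁, hij]
    · rw [h₂, hij]
    · rfl
  have h := columnDet_comp_perm_left M f g (Equiv.swap i j)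
  rw [hswap, Equiv.Perm.sign_swap hne] at h
  have h₂ : (2 : ℂ) • columnDet M f g = 0 := by
    rw [two_smul]
    nth_rw 1 [h]
    simp
  exact (smul_eq_zero_iff_right two_ne_zero).mp h₂

theorem cdetCoeff_eq_zero_of_lt {N m : ℕ} (M : Matrix (Fin N) (Fin N) A) (h : N < m) :
    cdetCoeff N M m = 0 := by
  rw [cdetCoeff_eq, Finset.sum_eq_zero, smul_zero]
  intro f _
  refine columnDet_eq_zero M f f fun hf => ?_
  have := Fintype.card_le_of_injective f hf
  simp only [Fintype.card_fin] at this
  omega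

/-- Newton's identity for a Manin matrix `M`:
`∂_z cdet(1+zM) = cdet(1+zM) ∑_{m≥0} (-z)^m tr(M^{m+1})`, stated as an identity
of formal power series in `z` (the left side is the coefficientwise derivative). -/
theorem manin_newton_identity (N : ℕ) (M : Matrix (Fin N) (Fin N) A)
    (hM : IsManin M) :
    (PowerSeries.mk fun n =>
        (n + 1 : ℕ) • (if n + 1 ≤ N then cdetCoeff N M (n + 1) else 0)) =
      cdetSeries N M *
        PowerSeries.mk (fun k => ((-1 : ℤ) ^ k) • Matrix.trace (M ^ (k + 1))) := by
  have hite : ∀ m, (if m ≤ N then cdetCoeff N M m else 0) = cdetCoeff N M m := fun m => by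
    split_ifs with h
    · rfl
    · exact (cdetCoeff_eq_zero_of_lt M (not_le.mp h)).symm
  ext n
  simp only [cdetSeries, hite, PowerSeries.coeff_mul, PowerSeries.coeff_mk]
  have h := hM.sum_borderedDet M n
  simp only [borderedDet_self, ← cdetCoeff_eq, ← pow_succ] at h
  rw [← h, cdetCoeff_eq, ← Nat.cast_smul_eq_nsmul ℂ, smul_smul, Nat.factorial_succ]
  congr 1
  push_cast
  field_simp

end
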